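/- Gluing lemma for moment relaxations: let z¹ ∈ Π_r(α,β) and z² ∈ Π_r(β,γ). Define z on multi-indices of length l ≤ 2r over the variables π_{ijk} (i∈[m], j∈[n], k∈[q]) by ℓ_z(∏_{s=1}^l π_{i_s j_s k_s}) = ℓ_{z¹}(∏_{s=1}^l π^{(1)}_{i_s j_s}) · ℓ_{z²}(∏_{s=1}^l π^{(2)}_{j_s k_s}) / ∏_{s=1}^l β_{j_s}. Then for every 1 ≤ l ≤ 2r and all index tuples: (i) ∑_{k₁,…,k_l ∈ [q]} ℓ_z(∏_{s=1}^l π_{i_s j_s k_s}) = ℓ_{z¹}(∏_{s=1}^l π^{(1)}_{i_s j_s}); (ii) ∑_{i₁,…,i_l ∈ [m]} ℓ_z(∏_{s=1}^l π_{i_s j_s k_s}) = ℓ_{z²}(∏_{s=1}^l π^{(2)}_{j_s k_s}); and (iii) the sequence z³ defined by ℓ_{z³}(∏_{s=1}^l π^{(3)}_{k_s i_s}) = ∑_{j₁,…,j_l ∈ [n]} ℓ_z(∏_{s=1}^l π_{i_s j_s k_s}) belongs to Π_r(γ,α). -/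

import Mathlib

open MvPolynomial

/-- The Riesz functional associated to a moment sequence `z`. -/
noncomputable def riesz {σ : Type*} (z : (σ →₀ ℕ) → ℝ) (p : MvPolynomial σ ℝ) : ℝ :=
  ∑ α ∈ p.support, MvPolynomial.coeff α p * z α

/-- The total degree (length) of a multi-index. -/
def mdeg {σ : Type*} (α : σ →₀ ℕ) : ℕ := α.sum fun _ e => e

/-- Positive semidefiniteness of the truncated localizing matrix `M_t(g z)`:
the associated quadratic form is nonnegative on coefficient vectors of
polynomials of degree at most `t`. -/
def locPSD {σ : Type*} (z : (σ →₀ ℕ) → ℝ) (g : MvPolynomial σ ℝ) (t : ℕ) : Prop :=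
  ∀ p : MvPolynomial σ ℝ, p.totalDegree ≤ t → 0 ≤ riesz z (g * p ^ 2)

/-- Vanishing of the truncated localizing matrix `M_t(g z)`: all entries are zero. -/
def locZero {σ : Type*} (z : (σ →₀ ℕ) → ℝ) (g : MvPolynomial σ ℝ) (t : ℕ) : Prop :=
  ∀ α β : σ →₀ ℕ, mdeg α ≤ t → mdeg β ≤ t →
    riesz z (g * monomial α 1 * monomial β 1) = 0

/-- The row-marginal polynomial `r_i(π) = ∑_j π_{ij} - μ_i`. -/
noncomputable def rowPoly (a b : ℕ) (μ : Fin a → ℝ) (i : Fin a) :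
    MvPolynomial (Fin a × Fin b) ℝ :=
  (∑ j, X (i, j)) - C (μ i)

/-- The column-marginal polynomial `c_j(π) = ∑_i π_{ij} - ν_j`. -/
noncomputable def colPoly (a b : ℕ) (ν : Fin b → ℝ) (j : Fin b) :
    MvPolynomial (Fin a × Fin b) ℝ :=
  (∑ i, X (i, j)) - C (ν j)

/-- The monomial `e_I = ∏_{(i,j) ∈ I} π_{ij}`. -/
noncomputable def eI {a b : ℕ} (I : Finset (Fin a × Fin b)) : MvPolynomial (Fin a × Fin b) ℝ :=
  ∏ q ∈ I, X q

/-- A probability vector: nonnegative entries summing to 1. -/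
def IsProbVec {a : ℕ} (μ : Fin a → ℝ) : Prop := (∀ i, 0 ≤ μ i) ∧ ∑ i, μ i = 1

/-- Feasibility for the level-`r` Schmüdgen moment relaxation (S-DGW-r). -/
def SFeas (a b r : ℕ) (μ : Fin a → ℝ) (ν : Fin b → ℝ)
    (z : ((Fin a × Fin b) →₀ ℕ) → ℝ) : Prop :=
  z 0 = 1 ∧
  (∀ I : Finset (Fin a × Fin b), I.card ≤ 2 * r → locPSD z (eI I) (r - (I.card + 1) / 2)) ∧
  (∀ i, locZero z (rowPoly a b μ i) (r - 1)) ∧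
  (∀ j, locZero z (colPoly a b ν j) (r - 1)) ∧
  (∀ i₁ i₂ : Fin a, ∀ j : Fin b, locZero z (rowPoly a b μ i₁ * X (i₂, j)) (r - 1)) ∧
  (∀ j₁ j₂ : Fin b, ∀ i : Fin a, locZero z (colPoly a b ν j₁ * X (i, j₂)) (r - 1))

/-- The objective of the Schmüdgen moment relaxation. -/
noncomputable def objS (a b : ℕ) (L : Fin a → Fin b → Fin a → Fin b → ℝ)
    (z : ((Fin a × Fin b) →₀ ℕ) → ℝ) : ℝ :=
  ∑ i, ∑ j, ∑ k, ∑ l, L i j k l * z (Finsupp.single (i, j) 1 + Finsupp.single (k, l) 1)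

/-- The optimal value of the level-`r` Schmüdgen moment relaxation. -/
noncomputable def valS (a b r : ℕ) (μ : Fin a → ℝ) (ν : Fin b → ℝ)
    (L : Fin a → Fin b → Fin a → Fin b → ℝ) : ℝ :=
  sInf {v : ℝ | ∃ z, SFeas a b r μ ν z ∧ v = objS a b L z}

theorem mdeg_eq_degree {σ : Type*} (τ : σ →₀ ℕ) : mdeg τ = τ.degree := rfl

theorem riesz_eq_sum_of_subset {σ : Type*} (z : (σ →₀ ℕ) → ℝ) {p : MvPolynomial σ ℝ}
    {S : Finset (σ →₀ ℕ)} (h : p.support ⊆ S) :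
    riesz z p = ∑ τ ∈ S, coeff τ p * z τ :=
  Finset.sum_subset h fun τ _ hτ => by rw [notMem_support_iff.mp hτ, zero_mul]

/-- The Riesz functional as a linear map. -/
noncomputable def rieszLin {σ : Type*} (z : (σ →₀ ℕ) → ℝ) : MvPolynomial σ ℝ →ₗ[ℝ] ℝ where
  toFun := riesz z
  map_add' p p' := by
    classical
    rw [riesz_eq_sum_of_subset z (S := p.support ∪ p'.support) support_add,
      riesz_eq_sum_of_subset z (S := p.support ∪ p'.support) Finset.subset_union_left,
      riesz_eq_sum_of_subset z (S := p.support ∪ p'.support) Finset.subset_union_right,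
      ← Finset.sum_add_distrib]
    exact Finset.sum_congr rfl fun τ _ => by rw [coeff_add, add_mul]
  map_smul' c p := by
    rw [riesz_eq_sum_of_subset z (support_smul (a := c) (f := p)), riesz, RingHom.id_apply,
      smul_eq_mul, Finset.mul_sum]
    exact Finset.sum_congr rfl fun τ _ => by rw [coeff_smul, smul_eq_mul, mul_assoc]

theorem riesz_eq_rieszLin {σ : Type*} (z : (σ →₀ ℕ) → ℝ) (p : MvPolynomial σ ℝ) :
    riesz z p = rieszLin z p := rfl

theorem rieszLin_monomial {σ : Type*} (z : (σ →₀ ℕ) → ℝ) (τ : σ →₀ ℕ) (c : ℝ) :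
    rieszLin z (monomial τ c) = c * z τ := by
  classical
  rw [← riesz_eq_rieszLin, riesz_eq_sum_of_subset z (support_monomial_subset (s := τ) (a := c)),
    Finset.sum_singleton, coeff_monomial, if_pos rfl]

theorem linearMap_eq_of_monomial {σ M : Type*} [AddCommMonoid M] [Module ℝ M]
    (F G : MvPolynomial σ ℝ →ₗ[ℝ] M) (d : ℕ)
    (h : ∀ τ : σ →₀ ℕ, τ.degree ≤ d → F (monomial τ 1) = G (monomial τ 1))
    {p : MvPolynomial σ ℝ} (hp : p.totalDegree ≤ d) : F p = G p := by
  rw [p.as_sum, map_sum, map_sum]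
  refine Finset.sum_congr rfl fun τ hτ => ?_
  have := h τ ((le_totalDegree hτ).trans hp)
  rw [← mul_one (coeff τ p), ← smul_eq_mul, ← smul_monomial, map_smul, map_smul, this]

theorem exists_eq_single_of_degree_eq_one {σ : Type*} {b : σ →₀ ℕ} (hb : b.degree = 1) :
    ∃ x, b = Finsupp.single x 1 := by
  have hb0 : b ≠ 0 := by rintro rfl; simp at hb
  obtain ⟨x, hx⟩ := Finsupp.ne_iff.mp hb0
  rw [Finsupp.zero_apply] at hx
  have hle : Finsupp.single x 1 ≤ b := Finsupp.single_le_iff.mpr (by omega)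
  obtain ⟨c, hc⟩ := exists_add_of_le hle
  refine ⟨x, ?_⟩
  have : c.degree = 0 := by
    rw [hc, map_add, Finsupp.degree_single] at hb; omega
  rw [Finsupp.degree_eq_zero_iff] at this
  rw [hc, this, add_zero]

theorem exists_fin_family {σ : Type*} (τ : σ →₀ ℕ) :
    ∃ f : Fin τ.degree → σ, τ = ∑ s, Finsupp.single (f s) 1 := by
  suffices ∀ d, ∀ τ : σ →₀ ℕ, τ.degree = d → ∃ f : Fin d → σ, τ = ∑ s, Finsupp.single (f s) 1 from
    this _ τ rfl
  intro d
  induction d with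
  | zero =>
    intro τ hτ
    exact ⟨Fin.elim0, by simpa [Finsupp.degree_eq_zero_iff] using hτ⟩
  | succ d ih =>
    intro τ hτ
    obtain ⟨a, ha, had⟩ := Finsupp.exists_le_degree_eq τ d (by omega)
    obtain ⟨b, rfl⟩ := exists_add_of_le ha
    obtain ⟨f, rfl⟩ := ih a had
    have hb : b.degree = 1 := by rw [map_add] at hτ; omega
    obtain ⟨x, rfl⟩ := exists_eq_single_of_degree_eq_one hb
    exact ⟨Fin.snoc f x, by simp [Fin.sum_univ_castSucc]⟩

theorem monomial_sum_single {σ ι : Type*} (S : Finset ι) (f : ι → σ) :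
    monomial (∑ s ∈ S, Finsupp.single (f s) 1) (1 : ℝ) = ∏ s ∈ S, X (f s) := by
  rw [monomial_sum_one]
  rfl

theorem riesz_prod_X {σ ι : Type*} (z : (σ →₀ ℕ) → ℝ) (S : Finset ι) (f : ι → σ) :
    riesz z (∏ s ∈ S, X (f s)) = z (∑ s ∈ S, Finsupp.single (f s) 1) := by
  rw [← monomial_sum_single, riesz_eq_rieszLin, rieszLin_monomial, one_mul]

theorem totalDegree_aeval_le {σ τ : Type*} (g : σ → MvPolynomial τ ℝ)
    (hg : ∀ x, (g x).totalDegree ≤ 1) (p : MvPolynomial σ ℝ) :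
    (aeval g p).totalDegree ≤ p.totalDegree := by
  conv_lhs => rw [p.as_sum, map_sum]
  refine totalDegree_finsetSum_le fun τ hτ => le_trans ?_ (le_totalDegree hτ)
  rw [aeval_monomial]
  refine (totalDegree_mul _ _).trans ?_
  rw [algebraMap_eq, totalDegree_C, zero_add]
  refine (totalDegree_finsetProd _ _).trans (Finset.sum_le_sum fun x _ => ?_)
  exact (totalDegree_pow _ _).trans (by simpa using Nat.mul_le_mul_left (τ x) (hg x))

theorem locZero_and_iff {σ : Type*} (z : (σ →₀ ℕ) → ℝ) (g : MvPolynomial σ ℝ) {r : ℕ}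
    (hr : 0 < r) :
    (locZero z g (r - 1) ∧ ∀ x, locZero z (g * X x) (r - 1)) ↔
      ∀ τ : σ →₀ ℕ, τ.degree < 2 * r → rieszLin z (g * monomial τ 1) = 0 := by
  have split : ∀ τ : σ →₀ ℕ, τ.degree ≤ 2 * (r - 1) → ∃ a b : σ →₀ ℕ,
      a.degree ≤ r - 1 ∧ b.degree ≤ r - 1 ∧ τ = a + b := by
    intro τ hτ
    obtain ⟨a, ha, had⟩ := Finsupp.exists_le_degree_eq τ (min τ.degree (r - 1)) (min_le_left _ _)
    obtain ⟨b, rfl⟩ := exists_add_of_le ha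
    rw [map_add] at hτ had
    exact ⟨a, b, by omega, by omega, rfl⟩
  constructor
  · rintro ⟨h0, h1⟩ τ hτ
    by_cases hd : τ.degree ≤ 2 * (r - 1)
    · obtain ⟨a, b, ha, hb, rfl⟩ := split τ hd
      have := h0 a b ha hb
      rwa [mul_assoc, monomial_mul, one_mul] at this
    · obtain ⟨c, hc, hcd⟩ := Finsupp.exists_le_degree_eq τ 1 (by omega)
      obtain ⟨τ', rfl⟩ := exists_add_of_le hc
      obtain ⟨x, rfl⟩ := exists_eq_single_of_degree_eq_one hcd
      rw [map_add, hcd] at hτ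
      obtain ⟨a, b, ha, hb, rfl⟩ := split τ' (by omega)
      have := h1 x a b ha hb
      rwa [mul_assoc, mul_assoc, monomial_mul, one_mul, ← pow_one (X x),
        ← monomial_single_add] at this
  · intro h
    refine ⟨fun a b ha hb => ?_, fun x a b ha hb => ?_⟩
    all_goals rw [mdeg_eq_degree] at ha hb
    · rw [mul_assoc, monomial_mul, one_mul]
      exact h _ (by rw [map_add]; omega)
    · rw [mul_assoc, mul_assoc, monomial_mul, one_mul, ← pow_one (X x), ← monomial_single_add]
      exact h _ (by rw [map_add, map_add, Finsupp.degree_single]; omega)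

theorem rieszLin_sum_X_sub_C_mul_monomial {σ κ : Type*} [Fintype κ] (z : (σ →₀ ℕ) → ℝ)
    (v : κ → σ) (c : ℝ) (τ : σ →₀ ℕ) :
    rieszLin z ((∑ k, X (v k) - C c) * monomial τ 1) =
      ∑ k, z (Finsupp.single (v k) 1 + τ) - c * z τ := by
  rw [sub_mul, map_sub, Finset.sum_mul, map_sum, C_mul_monomial, mul_one, rieszLin_monomial]
  congr 1
  refine Finset.sum_congr rfl fun k _ => ?_
  rw [← pow_one (X (v k)), ← monomial_single_add, rieszLin_monomial, one_mul]

theorem sFeas_iff {a b r : ℕ} (hr : 0 < r) (μ : Fin a → ℝ) (ν : Fin b → ℝ)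
    (z : ((Fin a × Fin b) →₀ ℕ) → ℝ) :
    SFeas a b r μ ν z ↔ z 0 = 1 ∧
      (∀ I : Finset (Fin a × Fin b), I.card ≤ 2 * r → locPSD z (eI I) (r - (I.card + 1) / 2)) ∧
      (∀ i, ∀ τ : (Fin a × Fin b) →₀ ℕ, τ.degree < 2 * r →
        rieszLin z (rowPoly a b μ i * monomial τ 1) = 0) ∧
      (∀ j, ∀ τ : (Fin a × Fin b) →₀ ℕ, τ.degree < 2 * r →
        rieszLin z (colPoly a b ν j * monomial τ 1) = 0) := by
  simp only [SFeas, ← locZero_and_iff z _ hr, Prod.forall]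
  constructor
  · rintro ⟨h1, h2, h3, h4, h5, h6⟩
    exact ⟨h1, h2, fun i => ⟨h3 i, h5 i⟩, fun j => ⟨h4 j, fun i j₂ => h6 j j₂ i⟩⟩
  · rintro ⟨h1, h2, h3, h4⟩
    exact ⟨h1, h2, fun i => (h3 i).1, fun j => (h4 j).1, fun i => (h3 i).2,
      fun j j₂ i => (h4 j).2 i j₂⟩

theorem SFeas.sum_row {a b r : ℕ} {μ : Fin a → ℝ} {ν : Fin b → ℝ}
    {z : ((Fin a × Fin b) →₀ ℕ) → ℝ} (h : SFeas a b r μ ν z) (hr : 0 < r) (i : Fin a)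
    {τ : (Fin a × Fin b) →₀ ℕ} (hτ : τ.degree < 2 * r) :
    ∑ j, z (Finsupp.single (i, j) 1 + τ) = μ i * z τ := by
  have := ((sFeas_iff hr μ ν z).mp h).2.2.1 i τ hτ
  rwa [rowPoly, rieszLin_sum_X_sub_C_mul_monomial, sub_eq_zero] at this

theorem SFeas.sum_col {a b r : ℕ} {μ : Fin a → ℝ} {ν : Fin b → ℝ}
    {z : ((Fin a × Fin b) →₀ ℕ) → ℝ} (h : SFeas a b r μ ν z) (hr : 0 < r) (j : Fin b)
    {τ : (Fin a × Fin b) →₀ ℕ} (hτ : τ.degree < 2 * r) :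
    ∑ i, z (Finsupp.single (i, j) 1 + τ) = ν j * z τ := by
  have := ((sFeas_iff hr μ ν z).mp h).2.2.2 j τ hτ
  rwa [colPoly, rieszLin_sum_X_sub_C_mul_monomial, sub_eq_zero] at this

theorem totalDegree_prod_sum_X_le {σ ι κ : Type*} [Fintype κ] (v : ι → κ → σ) (S : Finset ι) :
    (∏ s ∈ S, ∑ k, X (v s k) : MvPolynomial σ ℝ).totalDegree ≤ S.card := by
  refine (totalDegree_finsetProd _ _).trans ((Finset.sum_le_card_nsmul _ _ 1 fun s _ => ?_).trans
    (by simp))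
  exact totalDegree_finsetSum_le fun k _ => (totalDegree_X _).le

theorem rieszLin_prod_sum_X {σ ι κ : Type*} [Fintype κ] (z : (σ →₀ ℕ) → ℝ) (h0 : z 0 = 1)
    (D : ℕ) (v : ι → κ → σ) (c : ι → ℝ)
    (h : ∀ s, ∀ τ : σ →₀ ℕ, τ.degree < D → ∑ k, z (Finsupp.single (v s k) 1 + τ) = c s * z τ)
    (S : Finset ι) (hS : S.card ≤ D) :
    rieszLin z (∏ s ∈ S, ∑ k, X (v s k)) = ∏ s ∈ S, c s := by
  classical
  induction S using Finset.induction_on with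
  | empty =>
    rw [Finset.prod_empty, Finset.prod_empty, ← h0, ← one_mul (z 0), ← rieszLin_monomial]
    rfl
  | insert s S hs ih =>
    rw [Finset.card_insert_of_notMem hs] at hS
    rw [Finset.prod_insert hs, Finset.prod_insert hs, ← ih (by omega)]
    refine linearMap_eq_of_monomial
      (rieszLin z ∘ₗ LinearMap.mulLeft ℝ (∑ k, X (v s k))) (c s • rieszLin z) S.card ?_
      (totalDegree_prod_sum_X_le v S)
    intro τ hτ
    have := rieszLin_sum_X_sub_C_mul_monomial z (v s) 0 τ
    rw [map_zero, sub_zero, zero_mul, sub_zero, h s τ (by omega)] at this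
    simpa [rieszLin_monomial] using this

theorem sum_rieszLin_prod_X {σ κ : Type*} [Fintype κ] [DecidableEq κ]
    (z : (σ →₀ ℕ) → ℝ) (h0 : z 0 = 1) {D l : ℕ} (hl : l ≤ D) (v : Fin l → κ → σ) (c : Fin l → ℝ)
    (h : ∀ s, ∀ τ : σ →₀ ℕ, τ.degree < D → ∑ k, z (Finsupp.single (v s k) 1 + τ) = c s * z τ) :
    ∑ k : Fin l → κ, riesz z (∏ s, X (v s (k s))) = ∏ s, c s := by
  rw [← rieszLin_prod_sum_X z h0 D v c h Finset.univ (by simpa using hl), Fintype.prod_sum,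
    map_sum]
  rfl

/-- Nonnegativity of all localizing forms attached to monomials. -/
def MonomialPSD {σ : Type*} (z : (σ →₀ ℕ) → ℝ) (r : ℕ) : Prop :=
  ∀ e : σ →₀ ℕ, e.degree ≤ 2 * r → ∀ p : MvPolynomial σ ℝ,
    p.totalDegree ≤ r - (e.degree + 1) / 2 → 0 ≤ rieszLin z (monomial e 1 * p ^ 2)

theorem SFeas.monomialPSD {a b r : ℕ} {μ : Fin a → ℝ} {ν : Fin b → ℝ}
    {z : ((Fin a × Fin b) →₀ ℕ) → ℝ} (h : SFeas a b r μ ν z) : MonomialPSD z r := by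
  intro e he p hp
  set I : Finset (Fin a × Fin b) := {x | e x % 2 = 1} with hI
  set f : (Fin a × Fin b) →₀ ℕ := e.mapRange (· / 2) rfl with hf
  have hef : e = ∑ x ∈ I, Finsupp.single x 1 + (f + f) := by
    ext x
    simp only [Finsupp.add_apply, Finsupp.finsetSum_apply, hf, Finsupp.mapRange_apply,
      Finsupp.single_apply, Finset.sum_ite_eq', hI, Finset.mem_filter, Finset.mem_univ, true_and]
    split_ifs <;> omega
  have hdeg : e.degree = I.card + 2 * f.degree := by
    conv_lhs => rw [hef]
    simp [map_add, map_sum, Finsupp.degree_single, two_mul]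
  have key := h.2.1 I (by omega) (monomial f 1 * p) <| by
    refine (totalDegree_mul _ _).trans ?_
    have := (totalDegree_monomial f (one_ne_zero : (1 : ℝ) ≠ 0))
    change _ = f.degree at this
    omega
  have hmon : monomial e (1 : ℝ) * p ^ 2 = eI I * (monomial f 1 * p) ^ 2 := by
    conv_lhs => rw [hef, ← one_mul (1 : ℝ), ← monomial_mul, monomial_sum_single I fun x => x]
    rw [eI, mul_pow, ← mul_assoc, sq (monomial f 1), monomial_mul, one_mul]
  rwa [hmon]

theorem rieszLin_monomial_mul_sum_sq {σ ι : Type*} (z : (σ →₀ ℕ) → ℝ)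
    (e : σ →₀ ℕ) (S : Finset ι) (g : ι → σ →₀ ℕ) (x : ι → ℝ) :
    rieszLin z (monomial e 1 * (∑ i ∈ S, monomial (g i) (x i)) ^ 2) =
      ∑ i ∈ S, ∑ j ∈ S, x i * x j * z (e + g i + g j) := by
  rw [sq, Finset.sum_mul_sum]
  simp only [Finset.mul_sum, map_sum, monomial_mul, rieszLin_monomial, one_mul, add_assoc]

theorem MonomialPSD.posSemidef {σ ι : Type*} [Fintype ι] {z : (σ →₀ ℕ) → ℝ} {r : ℕ}
    (h : MonomialPSD z r) {e : σ →₀ ℕ} (he : e.degree ≤ 2 * r) (g : ι → σ →₀ ℕ)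
    (hg : ∀ i, (g i).degree ≤ r - (e.degree + 1) / 2) :
    (Matrix.of fun i j => z (e + g i + g j)).PosSemidef := by
  refine Matrix.PosSemidef.of_dotProduct_mulVec_nonneg ?_ fun x => ?_
  · ext i j
    simp [add_right_comm]
  · have := h e he (∑ i, monomial (g i) (x i)) (totalDegree_finsetSum_le fun i _ =>
      (totalDegree_monomial_le _ _).trans (hg i))
    rw [rieszLin_monomial_mul_sum_sq] at this
    refine this.trans_eq ?_
    simp only [dotProduct, Matrix.mulVec, Finset.mul_sum, Matrix.of_apply, Pi.star_apply,
      star_trivial]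
    exact Finset.sum_congr rfl fun i _ => Finset.sum_congr rfl fun j _ => by ring

theorem MonomialPSD.glue {σ σ₁ σ₂ : Type*} {z₁ : (σ₁ →₀ ℕ) → ℝ} {z₂ : (σ₂ →₀ ℕ) → ℝ}
    {z : (σ →₀ ℕ) → ℝ} {r : ℕ} (h₁ : MonomialPSD z₁ r) (h₂ : MonomialPSD z₂ r)
    (f₁ : σ → σ₁) (f₂ : σ → σ₂) (W : (σ →₀ ℕ) → ℝ) (hW : ∀ τ, 0 < W τ)
    (hWadd : ∀ τ τ', W (τ + τ') = W τ * W τ')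
    (hz : ∀ τ : σ →₀ ℕ, τ.degree ≤ 2 * r →
      z τ = z₁ (τ.mapDomain f₁) * z₂ (τ.mapDomain f₂) / W τ) :
    MonomialPSD z r := by
  intro e he p hp
  have hdeg : ∀ a : p.support, (a : σ →₀ ℕ).degree ≤ r - (e.degree + 1) / 2 := fun a =>
    (le_totalDegree a.2).trans hp
  have A₁ := h₁.posSemidef (e := e.mapDomain f₁) (by rwa [Finsupp.degree_mapDomain])
    (fun a : p.support => (a : σ →₀ ℕ).mapDomain f₁)
    (fun a => by simpa only [Finsupp.degree_mapDomain] using hdeg a)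
  have A₂ := h₂.posSemidef (e := e.mapDomain f₂) (by rwa [Finsupp.degree_mapDomain])
    (fun a : p.support => (a : σ →₀ ℕ).mapDomain f₂)
    (fun a => by simpa only [Finsupp.degree_mapDomain] using hdeg a)
  have key := (A₁.hadamard A₂).dotProduct_mulVec_nonneg
    (fun a : p.support => coeff (a : σ →₀ ℕ) p / W a)
  have hp' : p = ∑ a : p.support, monomial (a : σ →₀ ℕ) (coeff (a : σ →₀ ℕ) p) := by
    rw [Finset.sum_coe_sort p.support fun a => monomial a (coeff a p)]
    exact p.as_sum
  have heq : rieszLin z (monomial e 1 * p ^ 2) = (W e)⁻¹ *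
      ∑ a : p.support, ∑ b : p.support, (coeff (a : σ →₀ ℕ) p / W a) *
        (coeff (b : σ →₀ ℕ) p / W b) *
        (z₁ (e.mapDomain f₁ + (a : σ →₀ ℕ).mapDomain f₁ + (b : σ →₀ ℕ).mapDomain f₁) *
          z₂ (e.mapDomain f₂ + (a : σ →₀ ℕ).mapDomain f₂ + (b : σ →₀ ℕ).mapDomain f₂)) := by
    conv_lhs => rw [hp', rieszLin_monomial_mul_sum_sq]
    simp only [Finset.mul_sum]
    refine Finset.sum_congr rfl fun a _ => Finset.sum_congr rfl fun b _ => ?_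
    have ha := hdeg a
    have hb := hdeg b
    rw [hz _ (by rw [map_add, map_add]; omega), hWadd, hWadd]
    simp only [Finsupp.mapDomain_add]
    have := (hW e).ne'
    have := (hW a).ne'
    have := (hW b).ne'
    field_simp
  rw [heq]
  refine mul_nonneg (inv_nonneg.mpr (hW e).le) (key.trans_eq ?_)
  simp only [dotProduct, Matrix.mulVec, Finset.mul_sum, Matrix.hadamard_apply, Matrix.of_apply,
    Pi.star_apply, star_trivial]
  exact Finset.sum_congr rfl fun a _ => Finset.sum_congr rfl fun b _ => by ring

/-- The monomial `∏ β_j` attached to a multi-index in the variables `π_{ijk}`. -/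
noncomputable def glueWeight {m n q : ℕ} (β : Fin n → ℝ)
    (τ : (Fin m × Fin n × Fin q) →₀ ℕ) : ℝ :=
  τ.prod fun x e => β x.2.1 ^ e

section Glue

variable {m n q : ℕ} {β : Fin n → ℝ}

theorem glueWeight_zero : glueWeight β (0 : (Fin m × Fin n × Fin q) →₀ ℕ) = 1 :=
  Finsupp.prod_zero_index

theorem glueWeight_add (τ τ' : (Fin m × Fin n × Fin q) →₀ ℕ) :
    glueWeight β (τ + τ') = glueWeight β τ * glueWeight β τ' :=
  Finsupp.prod_add_index' (fun _ => pow_zero _) fun _ => pow_add _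

theorem glueWeight_single (x : Fin m × Fin n × Fin q) :
    glueWeight β (Finsupp.single x 1) = β x.2.1 := by
  rw [glueWeight, Finsupp.prod_single_index (by exact pow_zero _), pow_one]

theorem glueWeight_sum_single {ι : Type*} (S : Finset ι) (f : ι → Fin m × Fin n × Fin q) :
    glueWeight β (∑ s ∈ S, Finsupp.single (f s) 1) = ∏ s ∈ S, β (f s).2.1 := by
  classical
  induction S using Finset.induction_on with
  | empty => exact glueWeight_zero
  | insert s S hs ih =>
    rw [Finset.sum_insert hs, Finset.prod_insert hs, glueWeight_add, glueWeight_single, ih]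

theorem glueWeight_pos (hβ : ∀ j, 0 < β j) (τ : (Fin m × Fin n × Fin q) →₀ ℕ) :
    0 < glueWeight β τ :=
  Finset.prod_pos fun _ _ => pow_pos (hβ _) _

/-- The projection `(i, j, k) ↦ (i, j)`. -/
def projLeft (x : Fin m × Fin n × Fin q) : Fin m × Fin n := (x.1, x.2.1)

/-- The projection `(i, j, k) ↦ (j, k)`. -/
def projRight (x : Fin m × Fin n × Fin q) : Fin n × Fin q := x.2

/-- `z` is the gluing of `z₁` and `z₂` on multi-indices of length at most `D`. -/
def IsGlued (β : Fin n → ℝ) (D : ℕ) (z₁ : ((Fin m × Fin n) →₀ ℕ) → ℝ)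
    (z₂ : ((Fin n × Fin q) →₀ ℕ) → ℝ) (z : ((Fin m × Fin n × Fin q) →₀ ℕ) → ℝ) : Prop :=
  ∀ τ : (Fin m × Fin n × Fin q) →₀ ℕ, τ.degree ≤ D →
    z τ = z₁ (τ.mapDomain projLeft) * z₂ (τ.mapDomain projRight) / glueWeight β τ

variable {r : ℕ} {α : Fin m → ℝ} {γ : Fin q → ℝ} {z₁ : ((Fin m × Fin n) →₀ ℕ) → ℝ}
  {z₂ : ((Fin n × Fin q) →₀ ℕ) → ℝ} {z : ((Fin m × Fin n × Fin q) →₀ ℕ) → ℝ}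

theorem isGlued_of_prod_X {D : ℕ}
    (h : ∀ l : ℕ, l ≤ D → ∀ (i : Fin l → Fin m) (j : Fin l → Fin n) (k : Fin l → Fin q),
      riesz z (∏ s, X (i s, j s, k s)) =
        riesz z₁ (∏ s, X (i s, j s)) * riesz z₂ (∏ s, X (j s, k s)) / ∏ s, β (j s)) :
    IsGlued β D z₁ z₂ z := by
  intro τ hτ
  obtain ⟨f, hf⟩ := exists_fin_family τ
  have key := h τ.degree hτ (fun s => (f s).1) (fun s => (f s).2.1) (fun s => (f s).2.2)
  simp only [riesz_prod_X, Prod.mk.eta, ← hf] at key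
  have h₁ : τ.mapDomain projLeft = ∑ s, Finsupp.single ((f s).1, (f s).2.1) 1 := by
    conv_lhs => rw [hf]
    simp only [Finsupp.mapDomain_finsetSum, Finsupp.mapDomain_single, projLeft]
  have h₂ : τ.mapDomain projRight = ∑ s, Finsupp.single (f s).2 1 := by
    conv_lhs => rw [hf]
    simp only [Finsupp.mapDomain_finsetSum, Finsupp.mapDomain_single, projRight]
  have h₃ : glueWeight β τ = ∏ s, β (f s).2.1 := by
    conv_lhs => rw [hf]
    exact glueWeight_sum_single _ _
  rw [key, h₁, h₂, h₃]

theorem IsGlued.single_add {D : ℕ} (h : IsGlued β D z₁ z₂ z) (i : Fin m) (j : Fin n) (k : Fin q)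
    {τ : (Fin m × Fin n × Fin q) →₀ ℕ} (hτ : τ.degree < D) :
    z (Finsupp.single (i, j, k) 1 + τ) =
      z₁ (Finsupp.single (i, j) 1 + τ.mapDomain projLeft) *
        z₂ (Finsupp.single (j, k) 1 + τ.mapDomain projRight) / (β j * glueWeight β τ) := by
  rw [h _ (by rw [map_add, Finsupp.degree_single]; omega), glueWeight_add, glueWeight_single,
    Finsupp.mapDomain_add, Finsupp.mapDomain_add, Finsupp.mapDomain_single,
    Finsupp.mapDomain_single]
  rfl

theorem IsGlued.sum_left (h : IsGlued β (2 * r) z₁ z₂ z) (hr : 0 < r) (hβ : ∀ j, 0 < β j)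
    (h₁ : SFeas m n r α β z₁) (h₂ : SFeas n q r β γ z₂) (k : Fin q)
    {τ : (Fin m × Fin n × Fin q) →₀ ℕ} (hτ : τ.degree < 2 * r) :
    ∑ x : Fin m × Fin n, z (Finsupp.single (x.1, x.2, k) 1 + τ) = γ k * z τ := by
  have hW := (glueWeight_pos hβ τ).ne'
  have hj : ∀ j, ∑ i, z (Finsupp.single (i, j, k) 1 + τ) =
      z₂ (Finsupp.single (j, k) 1 + τ.mapDomain projRight) *
        (z₁ (τ.mapDomain projLeft) / glueWeight β τ) := fun j => by
    have := (hβ j).ne'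
    simp only [h.single_add _ j k hτ]
    rw [← Finset.sum_div, ← Finset.sum_mul,
      h₁.sum_col hr j (by rwa [Finsupp.degree_mapDomain])]
    field_simp
  rw [Fintype.sum_prod_type_right]
  simp only [hj]
  rw [← Finset.sum_mul, h₂.sum_col hr k (by rwa [Finsupp.degree_mapDomain]), h τ hτ.le]
  field_simp

theorem IsGlued.sum_right (h : IsGlued β (2 * r) z₁ z₂ z) (hr : 0 < r) (hβ : ∀ j, 0 < β j)
    (h₁ : SFeas m n r α β z₁) (h₂ : SFeas n q r β γ z₂) (i : Fin m)
    {τ : (Fin m × Fin n × Fin q) →₀ ℕ} (hτ : τ.degree < 2 * r) :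
    ∑ x : Fin n × Fin q, z (Finsupp.single (i, x.1, x.2) 1 + τ) = α i * z τ := by
  have hW := (glueWeight_pos hβ τ).ne'
  have hj : ∀ j, ∑ k, z (Finsupp.single (i, j, k) 1 + τ) =
      z₁ (Finsupp.single (i, j) 1 + τ.mapDomain projLeft) *
        (z₂ (τ.mapDomain projRight) / glueWeight β τ) := fun j => by
    have := (hβ j).ne'
    simp only [h.single_add i j _ hτ]
    rw [← Finset.sum_div, ← Finset.mul_sum,
      h₂.sum_row hr j (by rwa [Finsupp.degree_mapDomain])]
    field_simp
  rw [Fintype.sum_prod_type]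
  simp only [hj]
  rw [← Finset.sum_mul, h₁.sum_row hr i (by rwa [Finsupp.degree_mapDomain]), h τ hτ.le]
  field_simp

/-- The substitution `π_{ki} ↦ ∑_j π_{ijk}`. -/
noncomputable def marginalHom (m n q : ℕ) :
    MvPolynomial (Fin q × Fin m) ℝ →ₐ[ℝ] MvPolynomial (Fin m × Fin n × Fin q) ℝ :=
  aeval fun x => ∑ j, X (x.2, j, x.1)

theorem marginalHom_X (x : Fin q × Fin m) :
    marginalHom m n q (X x) = ∑ j, X (x.2, j, x.1) :=
  aeval_X _ _

theorem totalDegree_marginalHom_le (p : MvPolynomial (Fin q × Fin m) ℝ) :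
    (marginalHom m n q p).totalDegree ≤ p.totalDegree :=
  totalDegree_aeval_le _ (fun _ => totalDegree_finsetSum_le fun _ _ => (totalDegree_X _).le) p

theorem marginalHom_rowPoly (k : Fin q) :
    marginalHom m n q (rowPoly q m γ k) =
      ∑ x : Fin m × Fin n, X (x.1, x.2, k) - C (γ k) := by
  rw [rowPoly, map_sub, map_sum, Fintype.sum_prod_type]
  simp only [marginalHom_X]
  rw [marginalHom, aeval_C, algebraMap_eq]

theorem marginalHom_colPoly (i : Fin m) :
    marginalHom m n q (colPoly q m α i) =
      ∑ x : Fin n × Fin q, X (i, x.1, x.2) - C (α i) := by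
  rw [colPoly, map_sub, map_sum, Fintype.sum_prod_type_right]
  simp only [marginalHom_X]
  rw [marginalHom, aeval_C, algebraMap_eq]

variable {z₃ : ((Fin q × Fin m) →₀ ℕ) → ℝ}

theorem rieszLin_eq_rieszLin_marginalHom {D : ℕ}
    (h : ∀ l : ℕ, l ≤ D → ∀ (k : Fin l → Fin q) (i : Fin l → Fin m),
      riesz z₃ (∏ s, X (k s, i s)) = ∑ j : Fin l → Fin n, riesz z (∏ s, X (i s, j s, k s)))
    {p : MvPolynomial (Fin q × Fin m) ℝ} (hp : p.totalDegree ≤ D) :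
    rieszLin z₃ p = rieszLin z (marginalHom m n q p) := by
  refine linearMap_eq_of_monomial (rieszLin z₃)
    (rieszLin z ∘ₗ (marginalHom m n q).toLinearMap) D (fun τ hτ => ?_) hp
  obtain ⟨f, hf⟩ := exists_fin_family τ
  have key := h τ.degree hτ (fun s => (f s).1) (fun s => (f s).2)
  have hmon : monomial τ (1 : ℝ) = ∏ s, X (f s) := by
    conv_lhs => rw [hf]
    exact monomial_sum_single _ _
  rw [hmon, LinearMap.comp_apply, AlgHom.toLinearMap_apply,
    map_prod (marginalHom m n q)]
  simp only [marginalHom_X]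
  rw [Fintype.prod_sum, map_sum]
  exact key

theorem MonomialPSD.rieszLin_marginalHom_nonneg (h : MonomialPSD z r)
    {I : Finset (Fin q × Fin m)} (hI : I.card ≤ 2 * r) {p : MvPolynomial (Fin q × Fin m) ℝ}
    (hp : p.totalDegree ≤ r - (I.card + 1) / 2) :
    0 ≤ rieszLin z (marginalHom m n q (eI I * p ^ 2)) := by
  rw [map_mul, map_pow, eI, map_prod (marginalHom m n q)]
  simp only [marginalHom_X]
  rw [Finset.prod_sum, Finset.sum_mul, map_sum]
  refine Finset.sum_nonneg fun j _ => ?_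
  rw [← monomial_sum_single]
  refine h _ ?_ _ ?_
  · simpa [map_sum, Finsupp.degree_single] using hI
  · simpa [map_sum, Finsupp.degree_single] using (totalDegree_marginalHom_le p).trans hp

theorem IsGlued.apply_zero (h : IsGlued β (2 * r) z₁ z₂ z) (h₁ : z₁ 0 = 1) (h₂ : z₂ 0 = 1) :
    z 0 = 1 := by
  rw [h 0 (by simp), Finsupp.mapDomain_zero, Finsupp.mapDomain_zero, h₁, h₂, glueWeight_zero]
  norm_num

theorem IsGlued.sFeas_marginal (h : IsGlued β (2 * r) z₁ z₂ z) (hr : 0 < r) (hβ : ∀ j, 0 < β j)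
    (h₁ : SFeas m n r α β z₁) (h₂ : SFeas n q r β γ z₂)
    (h₃ : ∀ p : MvPolynomial (Fin q × Fin m) ℝ, p.totalDegree ≤ 2 * r →
      rieszLin z₃ p = rieszLin z (marginalHom m n q p)) :
    SFeas q m r γ α z₃ := by
  have hzero : ∀ (g : MvPolynomial (Fin q × Fin m) ℝ), g.totalDegree ≤ 1 →
      (∀ τ : (Fin m × Fin n × Fin q) →₀ ℕ, τ.degree < 2 * r →
        rieszLin z (marginalHom m n q g * monomial τ 1) = 0) →
      ∀ τ : (Fin q × Fin m) →₀ ℕ, τ.degree < 2 * r → rieszLin z₃ (g * monomial τ 1) = 0 := by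
    intro g hg hz τ hτ
    have hmon : (monomial τ (1 : ℝ)).totalDegree ≤ τ.degree := totalDegree_monomial_le _ _
    rw [h₃ _ ((totalDegree_mul _ _).trans (by omega)), map_mul]
    exact linearMap_eq_of_monomial (rieszLin z ∘ₗ LinearMap.mulLeft ℝ (marginalHom m n q g)) 0
      τ.degree (fun τ' hτ' => hz τ' (by omega)) ((totalDegree_marginalHom_le _).trans hmon)
  rw [sFeas_iff hr]
  refine ⟨?_, fun I hI p hp => ?_, fun k => hzero _ ?_ fun τ hτ => ?_,
    fun i => hzero _ ?_ fun τ hτ => ?_⟩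
  · have := h₃ (monomial 0 1) ((totalDegree_monomial_le _ _).trans (by simp))
    rw [rieszLin_monomial, one_mul, monomial_zero', C_1, map_one, ← C_1, ← monomial_zero',
      rieszLin_monomial, one_mul] at this
    rw [this, h.apply_zero h₁.1 h₂.1]
  · have hdeg : (eI I * p ^ 2).totalDegree ≤ 2 * r := by
      have h1 : (eI I).totalDegree ≤ I.card :=
        (totalDegree_finsetProd _ _).trans (by simp)
      have h2 := totalDegree_pow p 2
      have := totalDegree_mul (eI I) (p ^ 2)
      omega
    rw [riesz_eq_rieszLin, h₃ _ hdeg]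
    exact (h₁.monomialPSD.glue h₂.monomialPSD projLeft projRight (glueWeight β)
      (glueWeight_pos hβ) glueWeight_add h).rieszLin_marginalHom_nonneg hI hp
  · exact (totalDegree_sub_C_le _ _).trans
      (totalDegree_finsetSum_le fun _ _ => (totalDegree_X _).le)
  · rw [marginalHom_rowPoly, rieszLin_sum_X_sub_C_mul_monomial, sub_eq_zero]
    exact h.sum_left hr hβ h₁ h₂ k hτ
  · exact (totalDegree_sub_C_le _ _).trans
      (totalDegree_finsetSum_le fun _ _ => (totalDegree_X _).le)
  · rw [marginalHom_colPoly, rieszLin_sum_X_sub_C_mul_monomial, sub_eq_zero]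
    exact h.sum_right hr hβ h₁ h₂ i hτ

end Glue

/-- Gluing lemma for moment relaxations: given `z¹ ∈ Π_r(α,β)` and
`z² ∈ Π_r(β,γ)`, the glued sequence `z` (defined on monomials of degree ≤ 2r by
`ℓ_z(∏ π_{i_s j_s k_s}) = ℓ_{z¹}(∏ π_{i_s j_s})·ℓ_{z²}(∏ π_{j_s k_s}) / ∏ β_{j_s}`)
has marginals `z¹` and `z²`, and its `(γ,α)`-marginal `z³` belongs to `Π_r(γ,α)`. -/
theorem stmt18 (m n q r : ℕ) (hm : 0 < m) (hn : 0 < n) (hq : 0 < q) (hr : 0 < r)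
    (α : Fin m → ℝ) (β : Fin n → ℝ) (γ : Fin q → ℝ)
    (hα : IsProbVec α) (hβ : IsProbVec β) (hγ : IsProbVec γ)
    (hβpos : ∀ j, 0 < β j)
    (z1 : ((Fin m × Fin n) →₀ ℕ) → ℝ) (hz1 : SFeas m n r α β z1)
    (z2 : ((Fin n × Fin q) →₀ ℕ) → ℝ) (hz2 : SFeas n q r β γ z2)
    (z : ((Fin m × Fin n × Fin q) →₀ ℕ) → ℝ)
    (hzdef : ∀ l : ℕ, l ≤ 2 * r →
      ∀ (i : Fin l → Fin m) (j : Fin l → Fin n) (k : Fin l → Fin q),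
        riesz z (∏ s, X (i s, j s, k s)) =
          riesz z1 (∏ s, X (i s, j s)) * riesz z2 (∏ s, X (j s, k s))
            / ∏ s, β (j s)) :
    (∀ l : ℕ, 1 ≤ l → l ≤ 2 * r →
      ∀ (i : Fin l → Fin m) (j : Fin l → Fin n),
        ∑ k : Fin l → Fin q, riesz z (∏ s, X (i s, j s, k s))
          = riesz z1 (∏ s, X (i s, j s))) ∧
    (∀ l : ℕ, 1 ≤ l → l ≤ 2 * r →
      ∀ (j : Fin l → Fin n) (k : Fin l → Fin q),
        ∑ i : Fin l → Fin m, riesz z (∏ s, X (i s, j s, k s))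
          = riesz z2 (∏ s, X (j s, k s))) ∧
    (∀ z3 : ((Fin q × Fin m) →₀ ℕ) → ℝ,
      (∀ l : ℕ, l ≤ 2 * r →
        ∀ (k : Fin l → Fin q) (i : Fin l → Fin m),
          riesz z3 (∏ s, X (k s, i s))
            = ∑ j : Fin l → Fin n, riesz z (∏ s, X (i s, j s, k s))) →
      SFeas q m r γ α z3) := by
  refine ⟨fun l _ hl i j => ?_, fun l _ hl j k => ?_, fun z3 hz3 => ?_⟩
  · have hβ0 : ∏ s, β (j s) ≠ 0 := Finset.prod_ne_zero_iff.mpr fun s _ => (hβpos _).ne'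
    simp only [hzdef l hl]
    rw [← Finset.sum_div, ← Finset.mul_sum,
      sum_rieszLin_prod_X z2 hz2.1 hl (fun s k => (j s, k)) (fun s => β (j s))
        fun s _ hτ => hz2.sum_row hr (j s) hτ,
      mul_div_cancel_right₀ _ hβ0]
  · have hβ0 : ∏ s, β (j s) ≠ 0 := Finset.prod_ne_zero_iff.mpr fun s _ => (hβpos _).ne'
    simp only [hzdef l hl]
    rw [← Finset.sum_div, ← Finset.sum_mul,
      sum_rieszLin_prod_X z1 hz1.1 hl (fun s i => (i, j s)) (fun s => β (j s))
        fun s _ hτ => hz1.sum_col hr (j s) hτ,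
      mul_div_cancel_left₀ _ hβ0]
  · exact (isGlued_of_prod_X hzdef).sFeas_marginal hr hβpos hz1 hz2
      fun _ => rieszLin_eq_rieszLin_marginalHom hz3
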